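/- Extension of velocity-average convergence from compactly supported to bounded continuous test functions (intermediate claim in the proof of Lemma 2.2). Let d ≥ 1, T > 0, and let Ω ⊆ ℝ^d be an open set. Suppose (f_m) is a sequence of nonnegative integrable functions on (0,T)×Ω×ℝ^d converging weakly in L¹ to f, and that for each continuous compactly supported ψ : ℝ^d → ℝ the velocity averages (t,x) ↦ ∫_{ℝ^d} f_m(t,x,v)ψ(v) dv converge in L¹((0,T)×Ω). Then: (i) for every bounded continuous ψ : ℝ^d → ℝ, the averages ∫_{ℝ^d} f_m(t,x,v)ψ(v) dv converge to ∫_{ℝ^d} f(t,x,v)ψ(v) dv in L¹((0,T)×Ω); in particular ρ_{f_m} → ρ_f in L¹((0,T)×Ω). (ii) Moreover, there is a single subsequence of (f_m) along which, for every bounded continuous ψ : ℝ^d → ℝ, the averages ∫_{ℝ^d} f_m ψ dv converge to ∫_{ℝ^d} f ψ dv both Lebesgue-almost everywhere on (0,T)×Ω and in L¹((0,T)×Ω). -/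

import Mathlib

open MeasureTheory Filter Topology

/-- The restricted Lebesgue measure on `(0,T) × Ω × ℝ^d`. -/
noncomputable def kineticMeasure (d : ℕ) (T : ℝ) (Ω : Set (EuclideanSpace ℝ (Fin d))) :
    Measure (ℝ × EuclideanSpace ℝ (Fin d) × EuclideanSpace ℝ (Fin d)) :=
  volume.restrict ((Set.Ioo (0 : ℝ) T) ×ˢ (Ω ×ˢ (Set.univ : Set (EuclideanSpace ℝ (Fin d)))))

/-- The restricted Lebesgue measure on `(0,T) × Ω`. -/
noncomputable def baseMeasure (d : ℕ) (T : ℝ) (Ω : Set (EuclideanSpace ℝ (Fin d))) :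
    Measure (ℝ × EuclideanSpace ℝ (Fin d)) :=
  volume.restrict ((Set.Ioo (0 : ℝ) T) ×ˢ Ω)

/-- The local density `ρ_f(t,x) = ∫_{ℝ^d} f(t,x,v) dv`. -/
noncomputable def dens {d : ℕ}
    (f : ℝ × EuclideanSpace ℝ (Fin d) × EuclideanSpace ℝ (Fin d) → ℝ)
    (p : ℝ × EuclideanSpace ℝ (Fin d)) : ℝ :=
  ∫ v, f (p.1, p.2, v)

/-- The velocity average `(t,x) ↦ ∫_{ℝ^d} f(t,x,v) ψ(v) dv`. -/
noncomputable def velAvg {d : ℕ}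
    (f : ℝ × EuclideanSpace ℝ (Fin d) × EuclideanSpace ℝ (Fin d) → ℝ)
    (ψ : EuclideanSpace ℝ (Fin d) → ℝ)
    (p : ℝ × EuclideanSpace ℝ (Fin d)) : ℝ :=
  ∫ v, f (p.1, p.2, v) * ψ v

namespace VelAvgAux

/-- Squeeze helper. -/
lemma tendsto_zero_of_approx (a : ℕ → ℝ) (ha : ∀ m, 0 ≤ a m)
    (h : ∀ ε > 0, ∃ e : ℕ → ℝ, ∃ l < ε, Tendsto e atTop (𝓝 l) ∧ ∀ m, a m ≤ e m) :
    Tendsto a atTop (𝓝 0) := by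
  rw [Metric.tendsto_atTop]
  intro ε hε
  obtain ⟨e, l, hl, he, hae⟩ := h ε hε
  obtain ⟨N, hN⟩ := eventually_atTop.1 (he.eventually_lt_const hl)
  refine ⟨N, fun n hn => ?_⟩
  rw [Real.dist_eq, sub_zero, abs_of_nonneg (ha n)]
  exact (hae n).trans_lt (hN n hn)

section
variable {E : Type*} [NormedAddCommGroup E]

/-- Continuous cutoff. -/
noncomputable def chi (k : ℕ) (v : E) : ℝ := max 0 (min 1 ((k : ℝ) + 1 - ‖v‖))

lemma chi_cont (k : ℕ) : Continuous (chi k : E → ℝ) := by unfold chi; fun_prop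
lemma chi_nonneg (k : ℕ) (v : E) : 0 ≤ chi k v := le_max_left _ _
lemma chi_le (k : ℕ) (v : E) : chi k v ≤ 1 := max_le zero_le_one (min_le_left _ _)
lemma chi_zero (k : ℕ) (v : E) (h : v ∉ Metric.closedBall (0 : E) (k + 1)) : chi k v = 0 := by
  simp only [Metric.mem_closedBall, dist_zero_right, not_le] at h
  exact max_eq_left ((min_le_right _ _).trans (by linarith))
lemma chi_tendsto (v : E) : Tendsto (fun k => chi k v) atTop (𝓝 1) := by
  obtain ⟨N, hN⟩ := exists_nat_ge ‖v‖
  apply tendsto_const_nhds.congr'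
  filter_upwards [eventually_ge_atTop N] with k hk
  have : (N : ℝ) ≤ k := by exact_mod_cast hk
  unfold chi
  rw [min_eq_left (by linarith), max_eq_right zero_le_one]

lemma mul_chi_compact [ProperSpace E] (u : E → ℝ) (k : ℕ) :
    HasCompactSupport (fun v => u v * chi k v) :=
  HasCompactSupport.intro (isCompact_closedBall (0 : E) (k + 1)) fun v hv => by
    simp [chi_zero k v hv]

/-- continuous compactly supported functions are bounded -/
lemma bdd_mul_chi [ProperSpace E] (u : E → ℝ) (hu : Continuous u) (k : ℕ) :
    ∃ C, ∀ v, |u v * chi k v| ≤ C := by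
  obtain ⟨C, hC⟩ := (hu.mul (chi_cont k)).bounded_above_of_compact_support (mul_chi_compact u k)
  exact ⟨C, hC⟩

variable [MeasurableSpace E] [BorelSpace E] [SecondCountableTopology E]

lemma int_mul {X : Type*} [MeasurableSpace X] {μ : Measure X} {G w : X → ℝ} (hG : Integrable G μ)
    (hw : Measurable w) (hb : ∃ C, ∀ v, |w v| ≤ C) : Integrable (fun v => G v * w v) μ := by
  obtain ⟨C, hC⟩ := hb
  exact hG.mul_bdd hw.aestronglyMeasurable (ae_of_all _ hC)

lemma one_sub_chi_bdd (k : ℕ) (v : E) : |1 - chi k v| ≤ 1 := by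
  rw [abs_le]; constructor <;> linarith [chi_nonneg k v, chi_le k v]

lemma est {ν : Measure E} {G ψ w : E → ℝ} (hG : Integrable G ν)
    (hψ : Measurable ψ) (hψb : ∃ C, ∀ v, |ψ v| ≤ C)
    (hw : Measurable w) (hwb : ∃ C, ∀ v, |w v| ≤ C) (k : ℕ) {δ C : ℝ}
    (h : ∀ v, |ψ v - w v| ≤ δ + C * (1 - chi k v)) :
    |∫ v, G v * ψ v ∂ν - ∫ v, G v * w v ∂ν| ≤
      δ * ∫ v, |G v| ∂ν + C * ∫ v, |G v| * (1 - chi k v) ∂ν := by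
  rw [← integral_sub (int_mul hG hψ hψb) (int_mul hG hw hwb)]
  have h1 : Integrable (fun v => |G v| * (1 - chi k v)) ν :=
    int_mul hG.abs (measurable_const.sub (chi_cont k).measurable) ⟨1, one_sub_chi_bdd k⟩
  rw [← integral_const_mul, ← integral_const_mul,
    ← integral_add (hG.abs.const_mul _) (h1.const_mul _)]
  refine (abs_integral_le_integral_abs).trans (integral_mono ?_ ?_ ?_)
  · exact ((int_mul hG hψ hψb).sub (int_mul hG hw hwb)).abs
  · exact (hG.abs.const_mul _).add (h1.const_mul _)
  · intro v
    simp only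
    rw [← mul_sub, abs_mul]
    nlinarith [h v, abs_nonneg (G v)]

lemma tail {X : Type*} [MeasurableSpace X] {μ : Measure X} {G : X → ℝ} (hG : Integrable G μ)
    {π : X → E} (hπ : Measurable π) :
    Tendsto (fun k => ∫ q, |G q| * (1 - chi k (π q)) ∂μ) atTop (𝓝 0) := by
  have := tendsto_integral_of_dominated_convergence (μ := μ)
    (F := fun k q => |G q| * (1 - chi k (π q))) (f := fun _ => 0) (fun q => |G q|)
    (fun k => (int_mul hG.abs (measurable_const.sub ((chi_cont k).measurable.comp hπ))
      ⟨1, fun q => one_sub_chi_bdd k (π q)⟩).aestronglyMeasurable) hG.abs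
    (fun k => ae_of_all _ fun q => by
      rw [Real.norm_eq_abs, abs_mul, abs_abs]
      exact mul_le_of_le_one_right (abs_nonneg _) (one_sub_chi_bdd k _))
    (ae_of_all _ fun q => by
      simpa using ((chi_tendsto (π q)).const_sub 1).const_mul |G q|)
  simpa using this

lemma pt_bound {ψ u : E → ℝ} {C δ : ℝ} (hC : ∀ v, |ψ v| ≤ C) (hδ : 0 ≤ δ) (k : ℕ)
    (h : ∀ v ∈ Metric.closedBall (0 : E) (k + 1), |ψ v - u v| ≤ δ) (v : E) :
    |ψ v - u v * chi k v| ≤ δ + C * (1 - chi k v) := by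
  have h0 := chi_nonneg k v
  have h1 := chi_le k v
  have h2 : |ψ v - u v * chi k v| ≤ |ψ v - u v| * chi k v + |ψ v| * (1 - chi k v) := by
    have e : ψ v - u v * chi k v = (ψ v - u v) * chi k v + ψ v * (1 - chi k v) := by ring
    rw [e]
    refine (abs_add_le _ _).trans ?_
    rw [abs_mul, abs_mul, abs_of_nonneg h0, abs_of_nonneg (sub_nonneg.2 h1)]
  by_cases hv : v ∈ Metric.closedBall (0 : E) (k + 1)
  · nlinarith [h v hv, hC v, abs_nonneg (ψ v - u v)]
  · rw [chi_zero k v hv] at *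
    nlinarith [hC v]

/-- The pointwise (fixed base point) convergence. -/
lemma pointwise [ProperSpace E] {ν : Measure E} {G : ℕ → E → ℝ} {H : E → ℝ}
    (hG0 : ∀ m v, 0 ≤ G m v) (hG : ∀ m, Integrable (G m) ν) (hH : Integrable H ν)
    (u : ℕ → C(E, ℝ)) (hu : DenseRange u)
    (h1 : ∀ n k, Tendsto (fun m => ∫ v, G m v * (u n v * chi k v) ∂ν) atTop
      (𝓝 (∫ v, H v * (u n v * chi k v) ∂ν)))
    (h2 : ∀ k, Tendsto (fun m => ∫ v, G m v * (1 - chi k v) ∂ν) atTop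
      (𝓝 (∫ v, H v * (1 - chi k v) ∂ν)))
    (h3 : Tendsto (fun m => ∫ v, G m v * 1 ∂ν) atTop (𝓝 (∫ v, H v * 1 ∂ν)))
    (ψ : E → ℝ) (hψ : Continuous ψ) (hψb : ∃ C, ∀ v, |ψ v| ≤ C) :
    Tendsto (fun m => ∫ v, G m v * ψ v ∂ν) atTop (𝓝 (∫ v, H v * ψ v ∂ν)) := by
  obtain ⟨C, hC⟩ := hψb
  have hC0 : 0 ≤ C := (abs_nonneg _).trans (hC 0)
  simp only [mul_one] at h3
  rw [tendsto_iff_dist_tendsto_zero]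
  refine tendsto_zero_of_approx _ (fun _ => dist_nonneg) fun ε hε => ?_
  -- choose k
  have t := (tail hH (measurable_id (α := E))).const_mul (2 * C)
  simp only [mul_zero, id] at t
  obtain ⟨k, hk⟩ := (t.eventually_lt_const (half_pos hε)).exists
  set I := ∫ v, |H v| ∂ν with hI
  have hI0 : 0 ≤ I := integral_nonneg fun _ => abs_nonneg _
  set δ := ε / (4 * (I + 1)) with hδ
  have hδ0 : 0 < δ := by positivity
  have hδI : 2 * δ * I < ε / 2 := by
    have : δ * (4 * (I + 1)) = ε := by rw [hδ]; field_simp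
    nlinarith
  obtain ⟨n, hn⟩ : ∃ n, ∀ v ∈ Metric.closedBall (0 : E) (k + 1), |ψ v - u n v| ≤ δ := by
    have h := (ContinuousMap.tendsto_iff_forall_isCompact_tendstoUniformlyOn.1
      (tendsto_id (x := 𝓝 (⟨ψ, hψ⟩ : C(E, ℝ))))) _ (isCompact_closedBall (0 : E) (k + 1))
    rw [Metric.tendstoUniformlyOn_iff] at h
    obtain ⟨_, hx, n, rfl⟩ := mem_closure_iff_nhds.1 (hu ⟨ψ, hψ⟩) _ (h δ hδ0)
    exact ⟨n, fun v hv => (hx v hv).le⟩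
  have hb := pt_bound hC hδ0.le k hn
  have hwm : Measurable fun v => u n v * chi k v :=
    ((u n).continuous.mul (chi_cont k)).measurable
  have hwb := bdd_mul_chi _ (u n).continuous k
  have eH := est hH hψ.measurable ⟨C, hC⟩ hwm hwb k hb
  refine ⟨fun m => |∫ v, G m v * (u n v * chi k v) ∂ν - ∫ v, H v * (u n v * chi k v) ∂ν|
    + (δ * ∫ v, G m v ∂ν + C * ∫ v, G m v * (1 - chi k v) ∂ν)
    + (δ * I + C * ∫ v, |H v| * (1 - chi k v) ∂ν),
    |∫ v, H v * (u n v * chi k v) ∂ν - ∫ v, H v * (u n v * chi k v) ∂ν|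
    + (δ * ∫ v, H v ∂ν + C * ∫ v, H v * (1 - chi k v) ∂ν)
    + (δ * I + C * ∫ v, |H v| * (1 - chi k v) ∂ν), ?_, ?_, ?_⟩
  · have i1 : ∫ v, H v ∂ν ≤ I := integral_mono hH hH.abs fun v => le_abs_self _
    have m1 : Measurable fun v : E => 1 - chi k v := measurable_const.sub (chi_cont k).measurable
    have i2 : ∫ v, H v * (1 - chi k v) ∂ν ≤ ∫ v, |H v| * (1 - chi k v) ∂ν :=
      integral_mono (int_mul hH m1 ⟨1, one_sub_chi_bdd k⟩)
        (int_mul hH.abs m1 ⟨1, one_sub_chi_bdd k⟩) fun v =>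
        mul_le_mul_of_nonneg_right (le_abs_self _) (sub_nonneg.2 (chi_le k v))
    rw [sub_self, abs_zero]
    nlinarith [mul_le_mul_of_nonneg_left i1 hδ0.le, mul_le_mul_of_nonneg_left i2 hC0]
  · exact ((((h1 n k).sub_const _).abs).add ((h3.const_mul _).add ((h2 k).const_mul _))).add_const _
  · intro m
    have eG := est (hG m) hψ.measurable ⟨C, hC⟩ hwm hwb k hb
    simp only [abs_of_nonneg (hG0 m _)] at eG
    rw [Real.dist_eq]
    rw [abs_le] at *
    have a := le_abs_self (∫ v, G m v * (u n v * chi k v) ∂ν - ∫ v, H v * (u n v * chi k v) ∂ν)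
    have b := neg_abs_le (∫ v, G m v * (u n v * chi k v) ∂ν - ∫ v, H v * (u n v * chi k v) ∂ν)
    constructor <;> linarith [eG.1, eG.2, eH.1, eH.2]

end

/-- Diagonal a.e. extraction for countably many L¹-null sequences. -/
lemma diag {X : Type*} [MeasurableSpace X] {μ : Measure X} (a : ℕ → ℕ → X → ℝ)
    (ha : ∀ j m, Integrable (a j m) μ)
    (h : ∀ j, Tendsto (fun m => ∫ p, |a j m p| ∂μ) atTop (𝓝 0)) :
    ∃ φ : ℕ → ℕ, StrictMono φ ∧ ∀ j, ∀ᵐ p ∂μ, Tendsto (fun m => a j (φ m) p) atTop (𝓝 0) := by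
  obtain ⟨φ, hφ, hP⟩ := extraction_forall_of_eventually'
    (P := fun n k => ∀ j ∈ Finset.range (n + 1), ∫ p, |a j k p| ∂μ ≤ (1 / 2 : ℝ) ^ n) (by
      intro n
      have : ∀ᶠ k in atTop, ∀ j ∈ Finset.range (n + 1), ∫ p, |a j k p| ∂μ ≤ (1 / 2 : ℝ) ^ n := by
        rw [Finset.eventually_all]
        intro j _
        exact (h j).eventually_le_const (by positivity)
      exact eventually_atTop.1 this)
  refine ⟨φ, hφ, fun j => ?_⟩
  have hb : ∀ m, ∫ p, |a j (φ (m + j)) p| ∂μ ≤ (1 / 2 : ℝ) ^ m := fun m =>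
    (hP (m + j) j (by simp)).trans (pow_le_pow_of_le_one (by norm_num) (by norm_num) (by omega))
  have hs : ∫⁻ p, ∑' m, ‖a j (φ (m + j)) p‖ₑ ∂μ ≠ ⊤ := by
    rw [lintegral_tsum fun m => (ha j _).aestronglyMeasurable.enorm]
    have hsum : Summable fun m : ℕ => (1 / 2 : ℝ) ^ m := summable_geometric_two
    refine ne_top_of_le_ne_top hsum.tsum_ofReal_ne_top (ENNReal.tsum_le_tsum fun m => ?_)
    rw [← ofReal_integral_norm_eq_lintegral_enorm (ha j _)]
    exact ENNReal.ofReal_le_ofReal (hb m)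
  have hm : AEMeasurable (fun p => ∑' m, ‖a j (φ (m + j)) p‖ₑ) μ :=
    AEMeasurable.tsum fun m => (ha j _).aestronglyMeasurable.enorm
  filter_upwards [ae_lt_top' hm hs] with p hp
  have := ENNReal.tendsto_atTop_zero_of_tsum_ne_top hp.ne
  rw [← tendsto_add_atTop_iff_nat j]
  rw [tendsto_zero_iff_enorm_tendsto_zero]
  exact this

section
variable {E : Type*} [NormedAddCommGroup E] [ProperSpace E]
variable [MeasurableSpace E] [BorelSpace E] [SecondCountableTopology E]
variable {X : Type*} [MeasurableSpace X] {μ : Measure X} [SFinite μ] {ν : Measure E} [SFinite ν]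

lemma int_mul_snd {G : X × E → ℝ} (hG : Integrable G (μ.prod ν)) {w : E → ℝ} (hw : Measurable w)
    (hb : ∃ C, ∀ v, |w v| ≤ C) : Integrable (fun q => G q * w q.2) (μ.prod ν) :=
  int_mul hG (hw.comp measurable_snd) (hb.imp fun _ h q => h q.2)

lemma part_compact {F : ℕ → X × E → ℝ} {G : X × E → ℝ}
    (hF : ∀ m, Integrable (F m) (μ.prod ν)) (hG : Integrable G (μ.prod ν))
    (hweak : ∀ φ : X × E → ℝ, Measurable φ → (∃ C : ℝ, ∀ q, |φ q| ≤ C) →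
      Tendsto (fun m => ∫ q, F m q * φ q ∂(μ.prod ν)) atTop (𝓝 (∫ q, G q * φ q ∂(μ.prod ν))))
    {w : E → ℝ} (hw : Measurable w) (hwb : ∃ C, ∀ v, |w v| ≤ C)
    (g : X → ℝ) (hg : Integrable g μ)
    (h : Tendsto (fun m => ∫ p, |∫ v, F m (p, v) * w v ∂ν - g p| ∂μ) atTop (𝓝 0)) :
    Tendsto (fun m => ∫ p, |∫ v, F m (p, v) * w v ∂ν - ∫ v, G (p, v) * w v ∂ν| ∂μ)
      atTop (𝓝 0) := by
  have key : ∀ (K : X × E → ℝ), Integrable K (μ.prod ν) → ∀ S : Set X, MeasurableSet S →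
      ∫ q, K q * (S.indicator 1 q.1 * w q.2) ∂(μ.prod ν)
        = ∫ p in S, ∫ v, K (p, v) * w v ∂ν ∂μ := by
    intro K hK S hS
    rw [integral_prod, ← integral_indicator hS]
    · congr 1
      ext p
      by_cases hp : p ∈ S <;> simp [hp]
    · have := int_mul (int_mul_snd hK hw hwb)
        ((measurable_one.indicator hS).comp measurable_fst : Measurable
          fun q : X × E => (S.indicator 1 q.1 : ℝ)) ⟨1, fun q => by
            by_cases hp : q.1 ∈ S <;> simp [hp]⟩
      refine this.congr (ae_of_all _ fun q => ?_)
      simp only [Function.comp]; ring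
  have hae : g =ᵐ[μ] fun p => ∫ v, G (p, v) * w v ∂ν := by
    have iG := (int_mul_snd hG hw hwb).integral_prod_left
    refine hg.ae_eq_of_forall_setIntegral_eq _ _ iG fun S hS _ => ?_
    obtain ⟨C, hC⟩ := hwb
    have t1 := hweak (fun q => S.indicator 1 q.1 * w q.2)
      (((measurable_one.indicator hS).comp measurable_fst).mul (hw.comp measurable_snd))
      ⟨C, fun q => by
        by_cases hp : q.1 ∈ S
        · simpa [hp] using hC q.2
        · simpa [hp] using (abs_nonneg _).trans (hC q.2)⟩
    simp only [key _ (hF _) S hS, key _ hG S hS] at t1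
    have t2 : Tendsto (fun m => ∫ p in S, ∫ v, F m (p, v) * w v ∂ν ∂μ) atTop
        (𝓝 (∫ p in S, g p ∂μ)) := by
      rw [tendsto_iff_dist_tendsto_zero]
      refine squeeze_zero (fun _ => dist_nonneg) (fun m => ?_) h
      have iF := (int_mul_snd (hF m) hw ⟨C, hC⟩).integral_prod_left
      rw [Real.dist_eq, ← integral_sub iF.integrableOn hg.integrableOn]
      exact abs_integral_le_integral_abs.trans
        (setIntegral_le_integral (iF.sub hg).abs (ae_of_all _ fun _ => abs_nonneg _))
    exact tendsto_nhds_unique t2 t1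
  refine h.congr fun m => integral_congr_ae ?_
  filter_upwards [hae] with p hp
  rw [hp]

lemma part_one {F : ℕ → X × E → ℝ} {G : X × E → ℝ}
    (hF0 : ∀ m q, 0 ≤ F m q)
    (hF : ∀ m, Integrable (F m) (μ.prod ν)) (hG : Integrable G (μ.prod ν))
    (hweak : ∀ φ : X × E → ℝ, Measurable φ → (∃ C : ℝ, ∀ q, |φ q| ≤ C) →
      Tendsto (fun m => ∫ q, F m q * φ q ∂(μ.prod ν)) atTop (𝓝 (∫ q, G q * φ q ∂(μ.prod ν))))
    (havg : ∀ ψ : E → ℝ, Continuous ψ → HasCompactSupport ψ →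
      ∃ g : X → ℝ, Integrable g μ ∧
        Tendsto (fun m => ∫ p, |∫ v, F m (p, v) * ψ v ∂ν - g p| ∂μ) atTop (𝓝 0))
    (ψ : E → ℝ) (hψ : Continuous ψ) (hψb : ∃ C, ∀ v, |ψ v| ≤ C) :
    Tendsto (fun m => ∫ p, |∫ v, F m (p, v) * ψ v ∂ν - ∫ v, G (p, v) * ψ v ∂ν| ∂μ)
      atTop (𝓝 0) := by
  obtain ⟨C, hC⟩ := hψb
  have hC0 : 0 ≤ C := (abs_nonneg _).trans (hC 0)
  refine tendsto_zero_of_approx _ (fun _ => integral_nonneg fun _ => abs_nonneg _) fun ε hε => ?_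
  have t := (tail hG (measurable_snd (α := X) (β := E))).const_mul (2 * C)
  simp only [mul_zero] at t
  obtain ⟨k, hk⟩ := (t.eventually_lt_const hε).exists
  have hwm : Measurable fun v => ψ v * chi k v := (hψ.mul (chi_cont k)).measurable
  have hwb := bdd_mul_chi _ hψ k
  obtain ⟨g, hg, hgt⟩ := havg _ (hψ.mul (chi_cont k)) (mul_chi_compact ψ k)
  have tc := part_compact hF hG hweak hwm hwb g hg hgt
  have m1 : Measurable fun v : E => 1 - chi k v := measurable_const.sub (chi_cont k).measurable
  have b1 : ∃ C, ∀ v : E, |1 - chi k v| ≤ C := ⟨1, one_sub_chi_bdd k⟩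
  have t1 := hweak (fun q => 1 - chi k q.2) (m1.comp measurable_snd)
    ⟨1, fun q => one_sub_chi_bdd k q.2⟩
  have hb := pt_bound hC le_rfl k (u := ψ) (fun v _ => by simp)
  refine ⟨fun m => (∫ p, |∫ v, F m (p, v) * (ψ v * chi k v) ∂ν
      - ∫ v, G (p, v) * (ψ v * chi k v) ∂ν| ∂μ)
    + C * ∫ q, F m q * (1 - chi k q.2) ∂(μ.prod ν)
    + C * ∫ q, |G q| * (1 - chi k q.2) ∂(μ.prod ν),
    0 + C * ∫ q, G q * (1 - chi k q.2) ∂(μ.prod ν)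
      + C * ∫ q, |G q| * (1 - chi k q.2) ∂(μ.prod ν), ?_, ?_, ?_⟩
  · have i2 : ∫ q, G q * (1 - chi k q.2) ∂(μ.prod ν) ≤ ∫ q, |G q| * (1 - chi k q.2) ∂(μ.prod ν) :=
      integral_mono (int_mul_snd hG m1 b1) (int_mul_snd hG.abs m1 b1) fun v =>
        mul_le_mul_of_nonneg_right (le_abs_self _) (sub_nonneg.2 (chi_le k v.2))
    nlinarith [mul_le_mul_of_nonneg_left i2 hC0]
  · exact (tc.add (t1.const_mul _)).add_const _
  · intro m
    have jF := int_mul_snd (hF m) m1 b1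
    have jG := int_mul_snd hG.abs m1 b1
    have jd := ((int_mul_snd (hF m) hwm hwb).integral_prod_left.sub
      (int_mul_snd hG hwm hwb).integral_prod_left).abs
    have jd2 := ((int_mul_snd (hF m) hψ.measurable ⟨C, hC⟩).integral_prod_left.sub
      (int_mul_snd hG hψ.measurable ⟨C, hC⟩).integral_prod_left).abs
    beta_reduce
    rw [integral_prod _ jF, integral_prod _ jG, ← integral_const_mul, ← integral_const_mul]
    have kF := jF.integral_prod_left.const_mul C
    have kG := jG.integral_prod_left.const_mul C
    have e1 := integral_add (jd.add kF) kG
    have e2 := integral_add jd kF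
    simp only [Pi.sub_apply, Pi.add_apply] at e1 e2
    rw [← e2, ← e1]
    refine integral_mono_ae jd2 ((jd.add kF).add kG) ?_
    filter_upwards [(hF m).prod_right_ae, hG.prod_right_ae] with p pF pG
    have eF := est pF hψ.measurable ⟨C, hC⟩ hwm hwb k hb
    have eG := est pG hψ.measurable ⟨C, hC⟩ hwm hwb k hb
    simp only [abs_of_nonneg (hF0 m _)] at eF
    have a := le_abs_self (∫ v, F m (p, v) * (ψ v * chi k v) ∂ν
      - ∫ v, G (p, v) * (ψ v * chi k v) ∂ν)
    have b := neg_abs_le (∫ v, F m (p, v) * (ψ v * chi k v) ∂ν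
      - ∫ v, G (p, v) * (ψ v * chi k v) ∂ν)
    rw [abs_le] at eF eG ⊢
    constructor <;> linarith [eG.1, eG.2, eF.1, eF.2]

lemma part_two {F : ℕ → X × E → ℝ} {G : X × E → ℝ}
    (hF0 : ∀ m q, 0 ≤ F m q)
    (hF : ∀ m, Integrable (F m) (μ.prod ν)) (hG : Integrable G (μ.prod ν))
    (hone : ∀ ψ : E → ℝ, Continuous ψ → (∃ C, ∀ v, |ψ v| ≤ C) →
      Tendsto (fun m => ∫ p, |∫ v, F m (p, v) * ψ v ∂ν - ∫ v, G (p, v) * ψ v ∂ν| ∂μ)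
        atTop (𝓝 0)) :
    ∃ φ : ℕ → ℕ, StrictMono φ ∧ ∀ ψ : E → ℝ, Continuous ψ → (∃ C, ∀ v, |ψ v| ≤ C) →
      ∀ᵐ p ∂μ, Tendsto (fun m => ∫ v, F (φ m) (p, v) * ψ v ∂ν) atTop
        (𝓝 (∫ v, G (p, v) * ψ v ∂ν)) := by
  let u : ℕ → C(E, ℝ) := TopologicalSpace.denseSeq C(E, ℝ)
  have hu : DenseRange u := TopologicalSpace.denseRange_denseSeq _
  let B := {w : E → ℝ // Continuous w ∧ ∃ C, ∀ v, |w v| ≤ C}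
  let w0 : (ℕ × ℕ) ⊕ ℕ ⊕ Unit → B := fun i => match i with
    | .inl (n, k) => ⟨fun v => u n v * chi k v, (u n).continuous.mul (chi_cont k),
        bdd_mul_chi _ (u n).continuous k⟩
    | .inr (.inl k) => ⟨fun v => 1 - chi k v, continuous_const.sub (chi_cont k),
        1, one_sub_chi_bdd k⟩
    | .inr (.inr _) => ⟨fun _ => 1, continuous_const, 1, fun _ => by simp⟩
  obtain ⟨s, hs⟩ := exists_surjective_nat ((ℕ × ℕ) ⊕ ℕ ⊕ Unit)
  let w : ℕ → B := fun j => w0 (s j)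
  obtain ⟨φ, hφ, hd⟩ := diag (μ := μ)
    (fun j m p => ∫ v, F m (p, v) * (w j).1 v ∂ν - ∫ v, G (p, v) * (w j).1 v ∂ν)
    (fun j m => (int_mul_snd (hF m) (w j).2.1.measurable (w j).2.2).integral_prod_left.sub
      (int_mul_snd hG (w j).2.1.measurable (w j).2.2).integral_prod_left)
    (fun j => hone _ (w j).2.1 (w j).2.2)
  refine ⟨φ, hφ, fun ψ hψ hψb => ?_⟩
  filter_upwards [ae_all_iff.2 hd, ae_all_iff.2 fun m => (hF m).prod_right_ae,
    hG.prod_right_ae] with p h1 h2 h3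
  have h4 : ∀ i, Tendsto (fun m => ∫ v, F (φ m) (p, v) * (w0 i).1 v ∂ν) atTop
      (𝓝 (∫ v, G (p, v) * (w0 i).1 v ∂ν)) := by
    intro i
    obtain ⟨j, rfl⟩ := hs i
    exact tendsto_sub_nhds_zero_iff.1 (h1 j)
  exact pointwise (G := fun m v => F (φ m) (p, v)) (H := fun v => G (p, v))
    (fun m v => hF0 _ _) (fun m => h2 _) h3 u hu
    (fun n k => h4 (.inl (n, k))) (fun k => h4 (.inr (.inl k))) (h4 (.inr (.inr ()))) ψ hψ hψb

end

lemma mp_kinetic (d : ℕ) (T : ℝ) (Ω : Set (EuclideanSpace ℝ (Fin d))) (hΩ : MeasurableSet Ω) :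
    MeasurePreserving (MeasurableEquiv.prodAssoc :
      (ℝ × EuclideanSpace ℝ (Fin d)) × EuclideanSpace ℝ (Fin d) ≃ᵐ _)
      ((baseMeasure d T Ω).prod volume) (kineticMeasure d T Ω) := by
  have h := (volume_preserving_prodAssoc (α₁ := ℝ) (β₁ := EuclideanSpace ℝ (Fin d))
    (γ₁ := EuclideanSpace ℝ (Fin d))).restrict_preimage
    (s := (Set.Ioo (0 : ℝ) T) ×ˢ (Ω ×ˢ (Set.univ : Set (EuclideanSpace ℝ (Fin d)))))
    (measurableSet_Ioo.prod (hΩ.prod MeasurableSet.univ))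
  have e : (baseMeasure d T Ω).prod (volume : Measure (EuclideanSpace ℝ (Fin d)))
      = volume.restrict ((MeasurableEquiv.prodAssoc :
      (ℝ × EuclideanSpace ℝ (Fin d)) × EuclideanSpace ℝ (Fin d) ≃ᵐ _) ⁻¹'
      ((Set.Ioo (0 : ℝ) T) ×ˢ (Ω ×ˢ (Set.univ : Set (EuclideanSpace ℝ (Fin d)))))) := by
    have e2 : ((MeasurableEquiv.prodAssoc :
      (ℝ × EuclideanSpace ℝ (Fin d)) × EuclideanSpace ℝ (Fin d) ≃ᵐ _) ⁻¹'
      ((Set.Ioo (0 : ℝ) T) ×ˢ (Ω ×ˢ (Set.univ : Set (EuclideanSpace ℝ (Fin d))))))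
      = (Set.Ioo (0 : ℝ) T ×ˢ Ω) ×ˢ Set.univ := by
      ext ⟨⟨a, b⟩, c⟩
      simp [MeasurableEquiv.prodAssoc]
    rw [e2, Measure.volume_eq_prod (ℝ × EuclideanSpace ℝ (Fin d)), ← Measure.prod_restrict,
      Measure.restrict_univ]
    rfl
  rw [e]
  exact h

end VelAvgAux

/-- **Extension of velocity-average convergence to bounded continuous test functions.**
If `f_m ⇀ f` weakly in `L¹((0,T)×Ω×ℝ^d)` and the velocity averages against continuous
compactly supported test functions converge in `L¹((0,T)×Ω)`, then (i) for every bounded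
continuous `ψ` the averages `∫ f_m ψ dv` converge to `∫ f ψ dv` in `L¹((0,T)×Ω)`; in
particular `ρ_{f_m} → ρ_f` in `L¹((0,T)×Ω)`; and (ii) there is a single subsequence along
which, for every bounded continuous `ψ`, the averages converge both a.e. and in `L¹`. -/
theorem velocity_average_extension
    (d : ℕ) (hd : 1 ≤ d) (T : ℝ) (hT : 0 < T)
    (Ω : Set (EuclideanSpace ℝ (Fin d))) (hΩ : IsOpen Ω)
    (f : ℕ → ℝ × EuclideanSpace ℝ (Fin d) × EuclideanSpace ℝ (Fin d) → ℝ)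
    (flim : ℝ × EuclideanSpace ℝ (Fin d) × EuclideanSpace ℝ (Fin d) → ℝ)
    (hf_meas : ∀ m, Measurable (f m))
    (hf_nonneg : ∀ m q, 0 ≤ f m q)
    (hf_int : ∀ m, Integrable (f m) (kineticMeasure d T Ω))
    (hflim_meas : Measurable flim)
    (hflim_int : Integrable flim (kineticMeasure d T Ω))
    -- weak convergence in L¹ of `f_m` to `flim`
    (hweak : ∀ φ : ℝ × EuclideanSpace ℝ (Fin d) × EuclideanSpace ℝ (Fin d) → ℝ,
      Measurable φ → (∃ C : ℝ, ∀ q, |φ q| ≤ C) →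
      Tendsto (fun m => ∫ q, f m q * φ q ∂(kineticMeasure d T Ω)) atTop
        (𝓝 (∫ q, flim q * φ q ∂(kineticMeasure d T Ω))))
    -- convergence in `L¹((0,T)×Ω)` of the compactly supported velocity averages
    (havg : ∀ ψ : EuclideanSpace ℝ (Fin d) → ℝ, Continuous ψ → HasCompactSupport ψ →
      ∃ g : ℝ × EuclideanSpace ℝ (Fin d) → ℝ, Integrable g (baseMeasure d T Ω) ∧
        Tendsto (fun m => ∫ p, |velAvg (f m) ψ p - g p| ∂(baseMeasure d T Ω)) atTop (𝓝 0)) :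
    -- (i) convergence for every bounded continuous test function, with identified limit
    (∀ ψ : EuclideanSpace ℝ (Fin d) → ℝ, Continuous ψ → (∃ Cψ : ℝ, ∀ v, |ψ v| ≤ Cψ) →
      Tendsto (fun m => ∫ p, |velAvg (f m) ψ p - velAvg flim ψ p| ∂(baseMeasure d T Ω))
        atTop (𝓝 0)) ∧
    -- in particular the densities converge in L¹
    Tendsto (fun m => ∫ p, |dens (f m) p - dens flim p| ∂(baseMeasure d T Ω)) atTop (𝓝 0) ∧
    -- (ii) a single subsequence giving a.e. and L¹ convergence for all bounded continuous ψ
    ∃ φ : ℕ → ℕ, StrictMono φ ∧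
      ∀ ψ : EuclideanSpace ℝ (Fin d) → ℝ, Continuous ψ → (∃ Cψ : ℝ, ∀ v, |ψ v| ≤ Cψ) →
        (∀ᵐ p ∂(baseMeasure d T Ω),
          Tendsto (fun m => velAvg (f (φ m)) ψ p) atTop (𝓝 (velAvg flim ψ p))) ∧
        Tendsto (fun m => ∫ p, |velAvg (f (φ m)) ψ p - velAvg flim ψ p| ∂(baseMeasure d T Ω))
          atTop (𝓝 0) := by
  have hmp := VelAvgAux.mp_kinetic d T Ω hΩ.measurableSet
  have hme := (MeasurableEquiv.prodAssoc :
    (ℝ × EuclideanSpace ℝ (Fin d)) × EuclideanSpace ℝ (Fin d) ≃ᵐ _).measurableEmbedding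
  have : SFinite (baseMeasure d T Ω) := by unfold baseMeasure; infer_instance
  let F : ℕ → (ℝ × EuclideanSpace ℝ (Fin d)) × EuclideanSpace ℝ (Fin d) → ℝ :=
    fun m => f m ∘ MeasurableEquiv.prodAssoc
  let G : (ℝ × EuclideanSpace ℝ (Fin d)) × EuclideanSpace ℝ (Fin d) → ℝ :=
    flim ∘ MeasurableEquiv.prodAssoc
  have hF : ∀ m, Integrable (F m) ((baseMeasure d T Ω).prod volume) :=
    fun m => (hmp.integrable_comp_emb hme).2 (hf_int m)
  have hG : Integrable G ((baseMeasure d T Ω).prod volume) :=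
    (hmp.integrable_comp_emb hme).2 hflim_int
  have hvF : ∀ m ψ p, velAvg (f m) ψ p = ∫ v, F m (p, v) * ψ v := fun _ _ _ => rfl
  have hvG : ∀ ψ p, velAvg flim ψ p = ∫ v, G (p, v) * ψ v := fun _ _ => rfl
  have hF0 : ∀ m q, 0 ≤ F m q := fun m q => hf_nonneg m _
  have hw : ∀ φ : (ℝ × EuclideanSpace ℝ (Fin d)) × EuclideanSpace ℝ (Fin d) → ℝ,
      Measurable φ → (∃ C : ℝ, ∀ q, |φ q| ≤ C) →
      Tendsto (fun m => ∫ q, F m q * φ q ∂((baseMeasure d T Ω).prod volume)) atTop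
        (𝓝 (∫ q, G q * φ q ∂((baseMeasure d T Ω).prod volume))) := by
    rintro φ hφ ⟨C, hC⟩
    have h := hweak (φ ∘ MeasurableEquiv.prodAssoc.symm)
      (hφ.comp MeasurableEquiv.prodAssoc.symm.measurable) ⟨C, fun q => hC _⟩
    have e : ∀ K : ℝ × EuclideanSpace ℝ (Fin d) × EuclideanSpace ℝ (Fin d) → ℝ,
        ∫ q, K q * (φ ∘ MeasurableEquiv.prodAssoc.symm) q ∂(kineticMeasure d T Ω)
          = ∫ q, (K ∘ MeasurableEquiv.prodAssoc) q * φ q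
            ∂((baseMeasure d T Ω).prod volume) := by
      intro K
      rw [← hmp.integral_comp hme]
      simp only [Function.comp, MeasurableEquiv.symm_apply_apply]
    simp only [e] at h
    exact h
  have h1 : ∀ ψ : EuclideanSpace ℝ (Fin d) → ℝ, Continuous ψ → (∃ Cψ : ℝ, ∀ v, |ψ v| ≤ Cψ) →
      Tendsto (fun m => ∫ p, |velAvg (f m) ψ p - velAvg flim ψ p| ∂(baseMeasure d T Ω))
        atTop (𝓝 0) := by
    simp only [hvF, hvG] at havg ⊢
    exact VelAvgAux.part_one hF0 hF hG hw havg
  have h2 := VelAvgAux.part_two hF0 hF hG (by simpa only [hvF, hvG] using h1)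
  simp only [← hvF, ← hvG] at h2
  obtain ⟨φ, hφ, h2⟩ := h2
  refine ⟨h1, ?_, φ, hφ, fun ψ hψ hb => ⟨h2 ψ hψ hb, (h1 ψ hψ hb).comp hφ.tendsto_atTop⟩⟩
  have h3 := h1 (fun _ => 1) continuous_const ⟨1, fun _ => by simp⟩
  simpa only [velAvg, dens, mul_one] using h3
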